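/- arXiv:2211.06938 — 2 statements merged into one kernel-verified Lean document; each statement's English description precedes it below -/
import Mathlib

section
/- Let L be a Lie superalgebra over a commutative ring K. There is a short exact sequence 0 → B̃₀(L) → L⋏L → L² → 0, where the map L⋏L → L² sends x⋏y to [x,y]. -/
/-!
Basic definitions for Lie superalgebras over a commutative ring `K`,
graded ideals, the nonabelian (CP) exterior products and the Bogomolov multiplier.
-/

universe u v

namespace BogomolovSuper

/-- The sign `(-1)^{|i||j|}` attached to a pair of `ℤ₂`-degrees. -/
def sgn (i j : ZMod 2) : ℤ := (-1) ^ (i.val * j.val)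

/-- A Lie superalgebra structure on a `K`-module `L`: a `ℤ₂`-grading
`gr` with `L = gr 0 ⊕ gr 1` together with a super bracket satisfying
super skew-symmetry, the super Jacobi identity and `[x,x] = 0` for even `x`. -/
structure SuperAlg (K : Type u) [CommRing K] (L : Type v)
    [AddCommGroup L] [Module K L] where
  bk : L →ₗ[K] L →ₗ[K] L
  gr : ZMod 2 → Submodule K L
  gr_inf : gr 0 ⊓ gr 1 = ⊥
  gr_sup : gr 0 ⊔ gr 1 = ⊤
  bk_gr : ∀ i j : ZMod 2, ∀ x ∈ gr i, ∀ y ∈ gr j, bk x y ∈ gr (i + j)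
  skew : ∀ i j : ZMod 2, ∀ x ∈ gr i, ∀ y ∈ gr j, bk x y = -(sgn i j • bk y x)
  jacobi : ∀ i j : ZMod 2, ∀ x ∈ gr i, ∀ y ∈ gr j, ∀ z : L,
    bk x (bk y z) = bk (bk x y) z + sgn i j • bk y (bk x z)
  even_sq : ∀ x ∈ gr 0, bk x x = 0

variable {K : Type u} [CommRing K]

section Defs

variable {L L' E : Type v} [AddCommGroup L] [Module K L]
  [AddCommGroup L'] [Module K L'] [AddCommGroup E] [Module K E]

/-- A homomorphism of Lie superalgebras of even degree (degree zero). -/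
def IsSuperHom (s : SuperAlg K L) (s' : SuperAlg K L') (f : L →ₗ[K] L') : Prop :=
  (∀ x y : L, f (s.bk x y) = s'.bk (f x) (f y)) ∧
  (∀ i : ZMod 2, ∀ x ∈ s.gr i, f x ∈ s'.gr i)

/-- A graded (homogeneous) ideal of a Lie superalgebra. -/
def IsGradedIdeal (s : SuperAlg K L) (M : Submodule K L) : Prop :=
  (∀ x : L, ∀ m ∈ M, s.bk x m ∈ M ∧ s.bk m x ∈ M) ∧
  (∀ m ∈ M, ∃ m₀ ∈ M ⊓ s.gr 0, ∃ m₁ ∈ M ⊓ s.gr 1, m = m₀ + m₁)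

/-- The sub-Lie-superalgebra generated by a set: the smallest submodule
containing the set and closed under the bracket. -/
def lieSpan (s : SuperAlg K E) (S : Set E) : Submodule K E :=
  sInf {p : Submodule K E | S ⊆ p ∧ ∀ x ∈ p, ∀ y ∈ p, s.bk x y ∈ p}

/-- `K(L)`: the set of all brackets `[a,b]`. -/
def bkSet (s : SuperAlg K L) : Set L := {x : L | ∃ a b : L, x = s.bk a b}

/-- The derived subalgebra `L² = [L,L]` (as a submodule; it is a graded ideal). -/
def derived (s : SuperAlg K L) : Submodule K L := Submodule.span K (bkSet s)

/-- The descending central series of a Lie superalgebra. -/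
def lcs (s : SuperAlg K L) : ℕ → Submodule K L
  | 0 => ⊤
  | n + 1 => Submodule.span K {x : L | ∃ a ∈ lcs s n, ∃ b : L, x = s.bk a b}

/-- Nilpotency of a Lie superalgebra. -/
def IsNilpotentSuper (s : SuperAlg K L) : Prop := ∃ c : ℕ, lcs s c = ⊥

/-- A Lie super exterior pairing on a pair of graded ideals `M`, `N` of `(L, s)`,
with values in a Lie superalgebra `(E, t)`. -/
structure IsExtPairing (s : SuperAlg K L) (M N : Submodule K L)
    (t : SuperAlg K E) (ρ : L → L → E) : Prop where
  grade : ∀ i j : ZMod 2, ∀ m ∈ M ⊓ s.gr i, ∀ n ∈ N ⊓ s.gr j, ρ m n ∈ t.gr (i + j)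
  smul_left : ∀ (c : K) (i j : ZMod 2), ∀ m ∈ M ⊓ s.gr i, ∀ n ∈ N ⊓ s.gr j,
    ρ (c • m) n = c • ρ m n
  smul_right : ∀ (c : K) (i j : ZMod 2), ∀ m ∈ M ⊓ s.gr i, ∀ n ∈ N ⊓ s.gr j,
    ρ m (c • n) = c • ρ m n
  add_left : ∀ (i j : ZMod 2), ∀ m ∈ M ⊓ s.gr i, ∀ m' ∈ M ⊓ s.gr i, ∀ n ∈ N ⊓ s.gr j,
    ρ (m + m') n = ρ m n + ρ m' n
  add_right : ∀ (i j : ZMod 2), ∀ m ∈ M ⊓ s.gr i, ∀ n ∈ N ⊓ s.gr j, ∀ n' ∈ N ⊓ s.gr j,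
    ρ m (n + n') = ρ m n + ρ m n'
  bk_left : ∀ (i i' j : ZMod 2), ∀ m ∈ M ⊓ s.gr i, ∀ m' ∈ M ⊓ s.gr i', ∀ n ∈ N ⊓ s.gr j,
    ρ (s.bk m m') n = ρ m (s.bk m' n) - sgn i i' • ρ m' (s.bk m n)
  bk_right : ∀ (i j j' : ZMod 2), ∀ m ∈ M ⊓ s.gr i, ∀ n ∈ N ⊓ s.gr j, ∀ n' ∈ N ⊓ s.gr j',
    ρ m (s.bk n n') = sgn j' (i + j) • ρ (s.bk n' m) n - sgn i j • ρ (s.bk n m) n'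
  bk_pair : ∀ (i j i' j' : ZMod 2), ∀ m ∈ M ⊓ s.gr i, ∀ n ∈ N ⊓ s.gr j,
    ∀ m' ∈ M ⊓ s.gr i', ∀ n' ∈ N ⊓ s.gr j',
    t.bk (ρ m n) (ρ m' n') = -(sgn i j • ρ (s.bk n m) (s.bk m' n'))

/-- A Lie super `B̃₀`-pairing: an exterior pairing that moreover kills the
commutativity-preserving relations. -/
structure IsB0Pairing (s : SuperAlg K L) (M N : Submodule K L)
    (t : SuperAlg K E) (ρ : L → L → E)
    extends IsExtPairing s M N t ρ : Prop where
  rel_pair : ∀ (i j i' j' : ZMod 2), ∀ m ∈ M ⊓ s.gr i, ∀ n ∈ N ⊓ s.gr j,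
    ∀ m' ∈ M ⊓ s.gr i', ∀ n' ∈ N ⊓ s.gr j',
    s.bk m n + sgn i' j' • s.bk m' n' = 0 → ρ m n + sgn i' j' • ρ m' n' = 0
  rel_even : ∀ m ∈ M ⊓ s.gr 0, ∀ n ∈ N ⊓ s.gr 0, s.bk m n = 0 → ρ m n = 0

/-- The set of wedge generators `m ∧ n` (`m`, `n` homogeneous). -/
def wedgeSet (s : SuperAlg K L) (M N : Submodule K L) (ρ : L → L → E) : Set E :=
  {e : E | ∃ i j : ZMod 2, ∃ m ∈ M ⊓ s.gr i, ∃ n ∈ N ⊓ s.gr j, e = ρ m n}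

/-- `(E, t, ρ)` is the nonabelian exterior product `M ∧ N`: `ρ` is a universal
exterior pairing whose image generates `E`. -/
structure IsExtProduct (s : SuperAlg K L) (M N : Submodule K L)
    (t : SuperAlg K E) (ρ : L → L → E) : Prop where
  pairing : IsExtPairing s M N t ρ
  gen : Submodule.span K (wedgeSet s M N ρ) = ⊤
  lift : ∀ {E' : Type v} [AddCommGroup E'] [Module K E'],
    ∀ (t' : SuperAlg K E') (ρ' : L → L → E'), IsExtPairing s M N t' ρ' →
    ∃ f : E →ₗ[K] E', IsSuperHom t t' f ∧
      ∀ (i j : ZMod 2), ∀ m ∈ M ⊓ s.gr i, ∀ n ∈ N ⊓ s.gr j, f (ρ m n) = ρ' m n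

/-- `(E, t, ρ)` is the commutativity preserving (CP) exterior product `M ⋏ N`:
`ρ` is a universal `B̃₀`-pairing whose image generates `E`. -/
structure IsCPProduct (s : SuperAlg K L) (M N : Submodule K L)
    (t : SuperAlg K E) (ρ : L → L → E) : Prop where
  pairing : IsB0Pairing s M N t ρ
  gen : Submodule.span K (wedgeSet s M N ρ) = ⊤
  lift : ∀ {E' : Type v} [AddCommGroup E'] [Module K E'],
    ∀ (t' : SuperAlg K E') (ρ' : L → L → E'), IsB0Pairing s M N t' ρ' →
    ∃ f : E →ₗ[K] E', IsSuperHom t t' f ∧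
      ∀ (i j : ZMod 2), ∀ m ∈ M ⊓ s.gr i, ∀ n ∈ N ⊓ s.gr j, f (ρ m n) = ρ' m n

/-- Generators of `M₀(M,N)` inside the exterior product. -/
def M0Set (s : SuperAlg K L) (M N : Submodule K L) (ρ : L → L → E) : Set E :=
  {e : E | ∃ i j i' j' : ZMod 2, ∃ m ∈ M ⊓ s.gr i, ∃ n ∈ N ⊓ s.gr j,
      ∃ m' ∈ M ⊓ s.gr i', ∃ n' ∈ N ⊓ s.gr j',
      s.bk m n + sgn i' j' • s.bk m' n' = 0 ∧ e = ρ m n + sgn i' j' • ρ m' n'} ∪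
  {e : E | ∃ m ∈ M ⊓ s.gr 0, ∃ n ∈ N ⊓ s.gr 0, s.bk m n = 0 ∧ e = ρ m n}

/-- `M₀(M,N)`, the graded submodule of the exterior product generated
by the commutativity-preserving relations. -/
def M0 (s : SuperAlg K L) (M N : Submodule K L) (ρ : L → L → E) : Submodule K E :=
  Submodule.span K (M0Set s M N ρ)

/-- `κ` is the commutator map `κ̃ : m ∧ n ↦ [m,n]`. -/
def IsCommMap (s : SuperAlg K L) (M N : Submodule K L) (ρ : L → L → E)
    (κ : E →ₗ[K] L) : Prop :=
  ∀ (i j : ZMod 2), ∀ m ∈ M ⊓ s.gr i, ∀ n ∈ N ⊓ s.gr j, κ (ρ m n) = s.bk m n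

/-- The Bogomolov multiplier `B̃₀(L) = M(L)/M₀(L)` of `(L,s)` is trivial:
for any realization of the exterior product `L ∧ L` and of the commutator
map `κ̃`, the kernel `M(L)` of `κ̃` is contained in `M₀(L)`. -/
def HasTrivialBog (s : SuperAlg K L) : Prop :=
  ∀ {E' : Type v} [AddCommGroup E'] [Module K E'],
    ∀ (t : SuperAlg K E') (w : L → L → E'), IsExtProduct s ⊤ ⊤ t w →
    ∀ κ : E' →ₗ[K] L, IsCommMap s ⊤ ⊤ w κ → LinearMap.ker κ ≤ M0 s ⊤ ⊤ w

end Defs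

section Free

variable {F : Type v} [AddCommGroup F] [Module K F]

/-- `(F, sF)` is the free Lie superalgebra on the `ℤ₂`-graded set `X`. -/
structure IsFreeSuper (sF : SuperAlg K F) (X : ZMod 2 → Set F) : Prop where
  subset : ∀ i : ZMod 2, X i ⊆ sF.gr i
  gen : lieSpan sF (X 0 ∪ X 1) = ⊤
  lift : ∀ {M : Type v} [AddCommGroup M] [Module K M],
    ∀ (sM : SuperAlg K M) (f : F → M), (∀ i : ZMod 2, ∀ x ∈ X i, f x ∈ sM.gr i) →
    ∃ g : F →ₗ[K] M, IsSuperHom sF sM g ∧ ∀ x ∈ X 0 ∪ X 1, g x = f x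

end Free

end BogomolovSuper

namespace BogomolovSuper

section Helpers

variable {K : Type u} [CommRing K] {L E E' : Type v} [AddCommGroup L] [Module K L]
  [AddCommGroup E] [Module K E] [AddCommGroup E'] [Module K E']

lemma SuperAlg.exists_add (s : SuperAlg K L) (x : L) :
    ∃ a ∈ s.gr 0, ∃ b ∈ s.gr 1, x = a + b := by
  have hx : x ∈ s.gr 0 ⊔ s.gr 1 := by rw [s.gr_sup]; trivial
  obtain ⟨a, ha, b, hb, h⟩ := Submodule.mem_sup.1 hx
  exact ⟨a, ha, b, hb, h.symm⟩

lemma SuperAlg.eq_zero_of_mem_ne (s : SuperAlg K L) {i j : ZMod 2} (hij : i ≠ j) {x : L}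
    (hi : x ∈ s.gr i) (hj : x ∈ s.gr j) : x = 0 := by
  have h01 : x ∈ s.gr 0 ⊓ s.gr 1 := by
    fin_cases i <;> fin_cases j
    · exact absurd rfl hij
    · exact ⟨hi, hj⟩
    · exact ⟨hj, hi⟩
    · exact absurd rfl hij
  rwa [s.gr_inf, Submodule.mem_bot] at h01

/-- The generators of `M₀(L)` all of whose terms have one common degree. -/
def homM0Set (s : SuperAlg K L) (ρ : L → L → E) : Set E :=
  {e : E | ∃ i j i' j' : ZMod 2, i + j = i' + j' ∧ ∃ m ∈ s.gr i, ∃ n ∈ s.gr j,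
    ∃ m' ∈ s.gr i', ∃ n' ∈ s.gr j',
    s.bk m n + sgn i' j' • s.bk m' n' = 0 ∧ e = ρ m n + sgn i' j' • ρ m' n'}

variable {s : SuperAlg K L} {t : SuperAlg K E} {ρ : L → L → E}

lemma IsExtPairing.zero_left (h : IsExtPairing s ⊤ ⊤ t ρ) {j : ZMod 2} {n : L}
    (hn : n ∈ s.gr j) : ρ 0 n = 0 := by
  simpa using h.smul_left 0 0 j 0 (by simp) n (by simpa using hn)

lemma IsExtPairing.zero_right (h : IsExtPairing s ⊤ ⊤ t ρ) {i : ZMod 2} {m : L}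
    (hm : m ∈ s.gr i) : ρ m 0 = 0 := by
  simpa using h.smul_right 0 i 0 m (by simpa using hm) 0 (by simp)

lemma IsExtPairing.zsmul_right (h : IsExtPairing s ⊤ ⊤ t ρ) {i j : ZMod 2} {m n : L}
    (hm : m ∈ s.gr i) (hn : n ∈ s.gr j) (z : ℤ) : ρ m (z • n) = z • ρ m n := by
  simpa only [Int.cast_smul_eq_zsmul] using
    h.smul_right (z : K) i j m (by simpa using hm) n (by simpa using hn)

lemma IsExtPairing.mem_span_homM0Set (h : IsExtPairing s ⊤ ⊤ t ρ) {i j : ZMod 2} {m n : L}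
    (hm : m ∈ s.gr i) (hn : n ∈ s.gr j) (h0 : s.bk m n = 0) :
    ρ m n ∈ Submodule.span K (homM0Set s ρ) := by
  refine Submodule.subset_span ⟨i, j, i, j, rfl, m, hm, n, hn, 0, zero_mem _, 0, zero_mem _, ?_, ?_⟩
  · simp [h0]
  · simp [h.zero_left (zero_mem (s.gr 0))]

lemma IsExtPairing.M0_eq_span (h : IsExtPairing s ⊤ ⊤ t ρ) :
    M0 s ⊤ ⊤ ρ = Submodule.span K (homM0Set s ρ) := by
  apply le_antisymm
  · refine Submodule.span_le.2 ?_
    rintro e (⟨i, j, i', j', m, hm, n, hn, m', hm', n', hn', h0, rfl⟩ | ⟨m, hm, n, hn, h0, rfl⟩)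
    · replace hm := hm.2; replace hn := hn.2; replace hm' := hm'.2; replace hn' := hn'.2
      by_cases hij : i + j = i' + j'
      · exact Submodule.subset_span
          ⟨i, j, i', j', hij, m, hm, n, hn, m', hm', n', hn', h0, rfl⟩
      · have h1 : s.bk m n = 0 := by
          refine s.eq_zero_of_mem_ne hij (s.bk_gr i j m hm n hn) ?_
          rw [eq_neg_of_add_eq_zero_left h0]
          exact neg_mem (zsmul_mem (s.bk_gr i' j' m' hm' n' hn') _)
        have h2 : s.bk m' n' = 0 := by
          rw [h1, zero_add] at h0
          rcases neg_one_pow_eq_or ℤ (i'.val * j'.val) with hs | hs <;>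
            simpa [sgn, hs] using h0
        exact add_mem (h.mem_span_homM0Set hm hn h1)
          (zsmul_mem (h.mem_span_homM0Set hm' hn' h2) _)
    · exact h.mem_span_homM0Set hm.2 hn.2 h0
  · refine Submodule.span_mono ?_
    rintro e ⟨i, j, i', j', -, m, hm, n, hn, m', hm', n', hn', h0, rfl⟩
    exact Or.inl ⟨i, j, i', j', m, ⟨trivial, hm⟩, n, ⟨trivial, hn⟩, m', ⟨trivial, hm'⟩, n',
      ⟨trivial, hn'⟩, h0, rfl⟩

lemma IsExtPairing.homM0Set_homogeneous (h : IsExtPairing s ⊤ ⊤ t ρ) {e : E}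
    (he : e ∈ homM0Set s ρ) : ∃ i, e ∈ t.gr i := by
  obtain ⟨i, j, i', j', hij, m, hm, n, hn, m', hm', n', hn', -, rfl⟩ := he
  refine ⟨i + j, add_mem (h.grade i j m ⟨trivial, hm⟩ n ⟨trivial, hn⟩) (zsmul_mem ?_ _)⟩
  rw [hij]
  exact h.grade i' j' m' ⟨trivial, hm'⟩ n' ⟨trivial, hn'⟩

lemma IsExtPairing.exists_add_of_mem_M0 (h : IsExtPairing s ⊤ ⊤ t ρ) {e : E}
    (he : e ∈ M0 s ⊤ ⊤ ρ) :
    ∃ a ∈ M0 s ⊤ ⊤ ρ ⊓ t.gr 0, ∃ b ∈ M0 s ⊤ ⊤ ρ ⊓ t.gr 1, e = a + b := by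
  suffices hle : M0 s ⊤ ⊤ ρ ≤ (M0 s ⊤ ⊤ ρ ⊓ t.gr 0) ⊔ (M0 s ⊤ ⊤ ρ ⊓ t.gr 1) by
    obtain ⟨a, ha, b, hb, hab⟩ := Submodule.mem_sup.1 (hle he)
    exact ⟨a, ha, b, hb, hab.symm⟩
  conv_lhs => rw [h.M0_eq_span]
  refine Submodule.span_le.2 fun x hx => ?_
  have hxM : x ∈ M0 s ⊤ ⊤ ρ := by
    rw [h.M0_eq_span]; exact Submodule.subset_span hx
  obtain ⟨i, hi⟩ := h.homM0Set_homogeneous hx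
  fin_cases i
  · exact Submodule.mem_sup_left ⟨hxM, hi⟩
  · exact Submodule.mem_sup_right ⟨hxM, hi⟩

lemma IsExtPairing.bk_homM0Set (h : IsExtPairing s ⊤ ⊤ t ρ)
    (hgen : Submodule.span K (wedgeSet s ⊤ ⊤ ρ) = ⊤) (x : E) {e : E}
    (he : e ∈ homM0Set s ρ) : t.bk x e = 0 := by
  obtain ⟨i, j, i', j', hij, m, hm, n, hn, m', hm', n', hn', h0, rfl⟩ := he
  have hx : x ∈ Submodule.span K (wedgeSet s ⊤ ⊤ ρ) := by rw [hgen]; trivial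
  induction hx using Submodule.span_induction with
  | mem x hx =>
    obtain ⟨k, l, a, ha, b, hb, rfl⟩ := hx
    have hba := s.bk_gr l k b hb.2 a ha.2
    have hmn := s.bk_gr i j m hm n hn
    have hmn' := s.bk_gr i' j' m' hm' n' hn'
    rw [map_add, map_zsmul, h.bk_pair k l i j a ha b hb m ⟨trivial, hm⟩ n ⟨trivial, hn⟩,
      h.bk_pair k l i' j' a ha b hb m' ⟨trivial, hm'⟩ n' ⟨trivial, hn'⟩, smul_neg,
      smul_comm (sgn i' j'), ← neg_add, ← smul_add, ← h.zsmul_right hba hmn',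
      ← h.add_right (l + k) (i + j) _ ⟨trivial, hba⟩ _ ⟨trivial, hmn⟩ _
        ⟨trivial, zsmul_mem (hij ▸ hmn') _⟩, h0, h.zero_right hba, smul_zero, neg_zero]
  | zero => simp
  | add x y _ _ hx hy => rw [LinearMap.map_add₂, hx, hy, add_zero]
  | smul r x _ hx => rw [LinearMap.map_smul₂, hx, smul_zero]

lemma IsExtPairing.bk_M0_right (h : IsExtPairing s ⊤ ⊤ t ρ)
    (hgen : Submodule.span K (wedgeSet s ⊤ ⊤ ρ) = ⊤) (x : E) {e : E}
    (he : e ∈ M0 s ⊤ ⊤ ρ) : t.bk x e = 0 := by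
  have hle : Submodule.span K (homM0Set s ρ) ≤ LinearMap.ker (t.bk x) :=
    Submodule.span_le.2 fun _ hy => h.bk_homM0Set hgen x hy
  exact hle (h.M0_eq_span ▸ he)

lemma IsExtPairing.bk_M0_left (h : IsExtPairing s ⊤ ⊤ t ρ)
    (hgen : Submodule.span K (wedgeSet s ⊤ ⊤ ρ) = ⊤) {e : E}
    (he : e ∈ M0 s ⊤ ⊤ ρ) (x : E) : t.bk e x = 0 := by
  obtain ⟨e₀, ⟨hM₀, h₀⟩, e₁, ⟨hM₁, h₁⟩, rfl⟩ := h.exists_add_of_mem_M0 he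
  obtain ⟨x₀, hx₀, x₁, hx₁, rfl⟩ := t.exists_add x
  simp [t.skew 0 0 e₀ h₀ x₀ hx₀, t.skew 0 1 e₀ h₀ x₁ hx₁, t.skew 1 0 e₁ h₁ x₀ hx₀,
    t.skew 1 1 e₁ h₁ x₁ hx₁, h.bk_M0_right hgen _ hM₀, h.bk_M0_right hgen _ hM₁]

/-- The bracket induced on the quotient by a submodule of the centre. -/
def SuperAlg.quotBk (t : SuperAlg K E) (P : Submodule K E)
    (hl : ∀ e ∈ P, ∀ x, t.bk e x = 0) (hr : ∀ e ∈ P, ∀ x, t.bk x e = 0) :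
    (E ⧸ P) →ₗ[K] (E ⧸ P) →ₗ[K] (E ⧸ P) :=
  (P.liftQ
    (P.liftQ (t.bk.compr₂ P.mkQ) (fun e he => by ext x; simp [hl e he])).flip
    (fun e he => by
      ext x
      change P.mkQ (t.bk x e) = 0
      rw [hr e he, map_zero])).flip

lemma SuperAlg.quotBk_mk (t : SuperAlg K E) (P : Submodule K E)
    (hl : ∀ e ∈ P, ∀ x, t.bk e x = 0) (hr : ∀ e ∈ P, ∀ x, t.bk x e = 0) (x y : E) :
    t.quotBk P hl hr (P.mkQ x) (P.mkQ y) = P.mkQ (t.bk x y) := rfl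

/-- The quotient of a Lie superalgebra by a graded submodule of its centre. -/
def SuperAlg.quot (t : SuperAlg K E) (P : Submodule K E)
    (hl : ∀ e ∈ P, ∀ x, t.bk e x = 0) (hr : ∀ e ∈ P, ∀ x, t.bk x e = 0)
    (hP : ∀ e ∈ P, ∃ a ∈ P ⊓ t.gr 0, ∃ b ∈ P ⊓ t.gr 1, e = a + b) :
    SuperAlg K (E ⧸ P) where
  bk := t.quotBk P hl hr
  gr i := (t.gr i).map P.mkQ
  gr_inf := by
    rw [eq_bot_iff]
    rintro _ ⟨⟨a, ha, rfl⟩, ⟨b, hb, hab⟩⟩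
    have hmem : a - b ∈ P := (Submodule.Quotient.eq P).1 hab.symm
    obtain ⟨p, ⟨hpP, hp⟩, q, ⟨-, hq⟩, hpq⟩ := hP _ hmem
    have hap : a - p = b + q := by
      rw [sub_eq_iff_eq_add] at hpq ⊢
      rw [hpq]; abel
    have h0 : a - p ∈ t.gr 0 ⊓ t.gr 1 :=
      ⟨sub_mem ha hp, by rw [SetLike.mem_coe, hap]; exact add_mem hb hq⟩
    rw [t.gr_inf, Submodule.mem_bot, sub_eq_zero] at h0
    simpa [h0] using hpP
  gr_sup := by
    rw [← Submodule.map_sup, t.gr_sup, Submodule.map_top, Submodule.range_mkQ]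
  bk_gr := by
    rintro i j _ ⟨x, hx, rfl⟩ _ ⟨y, hy, rfl⟩
    exact ⟨_, t.bk_gr i j x hx y hy, rfl⟩
  skew := by
    rintro i j _ ⟨x, hx, rfl⟩ _ ⟨y, hy, rfl⟩
    simp only [quotBk_mk]
    rw [t.skew i j x hx y hy, map_neg, map_zsmul]
  jacobi := by
    rintro i j _ ⟨x, hx, rfl⟩ _ ⟨y, hy, rfl⟩ z
    obtain ⟨z, rfl⟩ := P.mkQ_surjective z
    simp only [quotBk_mk]
    rw [t.jacobi i j x hx y hy z, map_add, map_zsmul]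
  even_sq := by
    rintro _ ⟨x, hx, rfl⟩
    rw [quotBk_mk, t.even_sq x hx, map_zero]

lemma IsExtPairing.map {t' : SuperAlg K E'} (h : IsExtPairing s ⊤ ⊤ t ρ) {f : E →ₗ[K] E'}
    (hf : IsSuperHom t t' f) : IsExtPairing s ⊤ ⊤ t' (fun m n => f (ρ m n)) where
  grade i j m hm n hn := hf.2 _ _ (h.grade i j m hm n hn)
  smul_left r i j m hm n hn := by rw [h.smul_left r i j m hm n hn, map_smul]
  smul_right r i j m hm n hn := by rw [h.smul_right r i j m hm n hn, map_smul]
  add_left i j m hm m' hm' n hn := by rw [h.add_left i j m hm m' hm' n hn, map_add]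
  add_right i j m hm n hn n' hn' := by rw [h.add_right i j m hm n hn n' hn', map_add]
  bk_left i i' j m hm m' hm' n hn := by
    rw [h.bk_left i i' j m hm m' hm' n hn, map_sub, map_zsmul]
  bk_right i j j' m hm n hn n' hn' := by
    rw [h.bk_right i j j' m hm n hn n' hn', map_sub, map_zsmul, map_zsmul]
  bk_pair i j i' j' m hm n hn m' hm' n' hn' := by
    rw [← hf.1, h.bk_pair i j i' j' m hm n hn m' hm' n' hn', map_neg, map_zsmul]

lemma ext_of_wedgeSet (hgen : Submodule.span K (wedgeSet s ⊤ ⊤ ρ) = ⊤) {f g : E →ₗ[K] E'}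
    (hfg : ∀ (i j : ZMod 2), ∀ m ∈ (⊤ : Submodule K L) ⊓ s.gr i,
      ∀ n ∈ (⊤ : Submodule K L) ⊓ s.gr j, f (ρ m n) = g (ρ m n)) : f = g := by
  refine LinearMap.ext_on hgen ?_
  rintro _ ⟨i, j, m, hm, n, hn, rfl⟩
  exact hfg i j m hm n hn

/-- Any comparison map from the exterior product to the CP exterior product has kernel
contained in `M₀(L)`. -/
lemma IsCPProduct.ker_le_M0 {tC : SuperAlg K E'} {c : L → L → E'}
    (hC : IsCPProduct s ⊤ ⊤ tC c) (h : IsExtPairing s ⊤ ⊤ t ρ)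
    (hgen : Submodule.span K (wedgeSet s ⊤ ⊤ ρ) = ⊤) {f : E →ₗ[K] E'}
    (hf : ∀ (i j : ZMod 2), ∀ m ∈ (⊤ : Submodule K L) ⊓ s.gr i,
      ∀ n ∈ (⊤ : Submodule K L) ⊓ s.gr j, f (ρ m n) = c m n) :
    LinearMap.ker f ≤ M0 s ⊤ ⊤ ρ := by
  let P := M0 s ⊤ ⊤ ρ
  let q := t.quot P (fun e he => h.bk_M0_left hgen he) (fun e he x => h.bk_M0_right hgen x he)
    (fun e he => h.exists_add_of_mem_M0 he)
  have hq : IsSuperHom t q P.mkQ := ⟨fun x y => rfl, fun i x hx => ⟨x, hx, rfl⟩⟩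
  have hpair : IsB0Pairing s ⊤ ⊤ q (fun m n => P.mkQ (ρ m n)) :=
    { h.map hq with
      rel_pair := fun i j i' j' m hm n hn m' hm' n' hn' h0 => by
        rw [← map_zsmul, ← map_add, ← LinearMap.mem_ker, Submodule.ker_mkQ]
        exact Submodule.subset_span
          (Or.inl ⟨i, j, i', j', m, hm, n, hn, m', hm', n', hn', h0, rfl⟩)
      rel_even := fun m hm n hn h0 => by
        rw [← LinearMap.mem_ker, Submodule.ker_mkQ]
        exact Submodule.subset_span (Or.inr ⟨m, hm, n, hn, h0, rfl⟩) }
  obtain ⟨g, -, hg⟩ := hC.lift q _ hpair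
  have hgf : g ∘ₗ f = P.mkQ := ext_of_wedgeSet hgen fun i j m hm n hn => by
    rw [LinearMap.comp_apply, hf i j m hm n hn, hg i j m hm n hn]
  calc LinearMap.ker f ≤ LinearMap.ker (g ∘ₗ f) := LinearMap.ker_le_ker_comp f g
    _ = P := by rw [hgf, Submodule.ker_mkQ]

lemma IsB0Pairing.M0_le_ker {tC : SuperAlg K E'} {c : L → L → E'}
    (hc : IsB0Pairing s ⊤ ⊤ tC c) {f : E →ₗ[K] E'}
    (hf : ∀ (i j : ZMod 2), ∀ m ∈ (⊤ : Submodule K L) ⊓ s.gr i,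
      ∀ n ∈ (⊤ : Submodule K L) ⊓ s.gr j, f (ρ m n) = c m n) :
    M0 s ⊤ ⊤ ρ ≤ LinearMap.ker f := by
  refine Submodule.span_le.2 ?_
  rintro e (⟨i, j, i', j', m, hm, n, hn, m', hm', n', hn', h0, rfl⟩ | ⟨m, hm, n, hn, h0, rfl⟩)
  · rw [SetLike.mem_coe, LinearMap.mem_ker, map_add, map_zsmul, hf i j m hm n hn,
      hf i' j' m' hm' n' hn']
    exact hc.rel_pair i j i' j' m hm n hn m' hm' n' hn' h0
  · rw [SetLike.mem_coe, LinearMap.mem_ker, hf 0 0 m hm n hn]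
    exact hc.rel_even m hm n hn h0

lemma IsCommMap.range_eq_derived (hgen : Submodule.span K (wedgeSet s ⊤ ⊤ ρ) = ⊤)
    {κ : E →ₗ[K] L} (hκ : IsCommMap s ⊤ ⊤ ρ κ) : LinearMap.range κ = derived s := by
  apply le_antisymm
  · rw [LinearMap.range_eq_map, ← hgen, Submodule.map_span_le]
    rintro _ ⟨i, j, m, hm, n, hn, rfl⟩
    rw [hκ i j m hm n hn]
    exact Submodule.subset_span ⟨m, n, rfl⟩
  · refine Submodule.span_le.2 ?_
    rintro _ ⟨a, b, rfl⟩
    have hom : ∀ i j, ∀ m ∈ s.gr i, ∀ n ∈ s.gr j, s.bk m n ∈ LinearMap.range κ :=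
      fun i j m hm n hn => ⟨ρ m n, hκ i j m ⟨trivial, hm⟩ n ⟨trivial, hn⟩⟩
    obtain ⟨a₀, ha₀, a₁, ha₁, rfl⟩ := s.exists_add a
    obtain ⟨b₀, hb₀, b₁, hb₁, rfl⟩ := s.exists_add b
    simp only [map_add, LinearMap.add_apply]
    exact add_mem (add_mem (hom _ _ _ ha₀ _ hb₀) (hom _ _ _ ha₁ _ hb₀))
      (add_mem (hom _ _ _ ha₀ _ hb₁) (hom _ _ _ ha₁ _ hb₁))

end Helpers

/-- For a Lie superalgebra `(L,s)` there is a short exact sequence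
`0 → B̃₀(L) → L ⋏ L → L² → 0`, where the map `L ⋏ L → L²` sends `x ⋏ y` to `[x,y]`.
Here `B̃₀(L) = M(L)/M₀(L)` is computed from a realization `(E, tW, w)` of the exterior
product `L ∧ L` with commutator map `κW` (so `M(L) = ker κW`), `L ⋏ L` is a realization
`(E', tC, c)` of the CP exterior product, `κC` is its commutator map, and exactness
means: there is an injective linear map `B̃₀(L) → L ⋏ L` whose range is exactly the
kernel of `κC`, and the range of `κC` is exactly `L² = [L,L]`. -/
theorem bogomolov_short_exact_sequence
    {K : Type u} [CommRing K] {L E E' : Type v}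
    [AddCommGroup L] [Module K L] [AddCommGroup E] [Module K E]
    [AddCommGroup E'] [Module K E']
    (s : SuperAlg K L)
    (tW : SuperAlg K E) (w : L → L → E) (hW : IsExtProduct s ⊤ ⊤ tW w)
    (κW : E →ₗ[K] L) (hκW : IsCommMap s ⊤ ⊤ w κW)
    (tC : SuperAlg K E') (c : L → L → E') (hC : IsCPProduct s ⊤ ⊤ tC c)
    (κC : E' →ₗ[K] L) (hκC : IsCommMap s ⊤ ⊤ c κC) :
    ∃ ι : (↥(LinearMap.ker κW) ⧸
        Submodule.comap (LinearMap.ker κW).subtype (M0 s ⊤ ⊤ w)) →ₗ[K] E',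
      Function.Injective ι ∧
      LinearMap.range ι = LinearMap.ker κC ∧
      LinearMap.range κC = derived s := by
  obtain ⟨f, -, hf⟩ := hW.lift tC c hC.pairing.toIsExtPairing
  have hker : LinearMap.ker f = M0 s ⊤ ⊤ w :=
    le_antisymm (hC.ker_le_M0 hW.pairing hW.gen hf) (hC.pairing.M0_le_ker hf)
  have hκ : κC ∘ₗ f = κW := ext_of_wedgeSet hW.gen fun i j m hm n hn => by
    rw [LinearMap.comp_apply, hf i j m hm n hn, hκC i j m hm n hn, hκW i j m hm n hn]
  have hsurj : LinearMap.range f = ⊤ := by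
    rw [eq_top_iff, ← hC.gen, Submodule.span_le]
    rintro _ ⟨i, j, m, hm, n, hn, rfl⟩
    exact ⟨w m n, hf i j m hm n hn⟩
  have hkr : LinearMap.ker (f ∘ₗ (LinearMap.ker κW).subtype) =
      Submodule.comap (LinearMap.ker κW).subtype (M0 s ⊤ ⊤ w) := by
    rw [LinearMap.ker_comp, hker]
  refine ⟨Submodule.liftQ _ (f ∘ₗ (LinearMap.ker κW).subtype) hkr.ge, ?_, ?_,
    hκC.range_eq_derived hC.gen⟩
  · exact LinearMap.ker_eq_bot.1 (Submodule.ker_liftQ_eq_bot _ _ _ hkr.le)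
  · rw [Submodule.range_liftQ, LinearMap.range_comp, Submodule.range_subtype, ← hκ,
      LinearMap.ker_comp, Submodule.map_comap_eq, hsurj, top_inf_eq]

end BogomolovSuper
end

section
/- Let L be a Lie superalgebra with a free presentation 0 → R → F →^π L → 0 and let T be a graded ideal of F containing R, with M = T/R the corresponding ideal of L. Then the sequence 0 → (R ∩ ⟨K(F) ∩ T⟩)/⟨K(F) ∩ R⟩ → B̃₀(L) → B̃₀(L/M) → (M ∩ L²)/⟨K(L) ∩ M⟩ → 0 is exact. -/
/-!
Basic definitions for Lie superalgebras over a commutative ring `K`,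
graded ideals, the nonabelian (CP) exterior products and the Bogomolov multiplier.
-/

universe u v

namespace BogomolovSuper

section LieSpan

variable {K : Type u} [CommRing K] {L F : Type v}
  [AddCommGroup L] [Module K L] [AddCommGroup F] [Module K F]

theorem lieSpan_le {s : SuperAlg K L} {S : Set L} {p : Submodule K L} (hS : S ⊆ p)
    (hp : ∀ x ∈ p, ∀ y ∈ p, s.bk x y ∈ p) : lieSpan s S ≤ p :=
  sInf_le ⟨hS, hp⟩

theorem subset_lieSpan (s : SuperAlg K L) (S : Set L) : S ⊆ lieSpan s S :=
  fun _ hx => Submodule.mem_sInf.2 fun _ hp => hp.1 hx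

theorem bk_mem_lieSpan (s : SuperAlg K L) (S : Set L) {x y : L} (hx : x ∈ lieSpan s S)
    (hy : y ∈ lieSpan s S) : s.bk x y ∈ lieSpan s S :=
  Submodule.mem_sInf.2 fun p hp =>
    hp.2 x (Submodule.mem_sInf.1 hx p hp) y (Submodule.mem_sInf.1 hy p hp)

theorem lieSpan_mono (s : SuperAlg K L) {S S' : Set L} (h : S ⊆ S') :
    lieSpan s S ≤ lieSpan s S' :=
  lieSpan_le (h.trans (subset_lieSpan s S')) fun _ hx _ hy => bk_mem_lieSpan s S' hx hy

theorem lieSpan_bkSet_inter_le_derived (s : SuperAlg K L) (S : Set L) :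
    lieSpan s (bkSet s ∩ S) ≤ derived s :=
  lieSpan_le (fun _ hx => Submodule.subset_span hx.1)
    fun x _ y _ => Submodule.subset_span ⟨x, y, rfl⟩

theorem map_lieSpan {sF : SuperAlg K F} {s : SuperAlg K L} {π : F →ₗ[K] L}
    (hπ : ∀ x y, π (sF.bk x y) = s.bk (π x) (π y)) (S : Set F) :
    (lieSpan sF S).map π = lieSpan s (π '' S) := by
  apply le_antisymm
  · rw [Submodule.map_le_iff_le_comap]
    refine lieSpan_le (fun x hx => subset_lieSpan s _ ⟨x, hx, rfl⟩) fun x hx y hy => ?_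
    rw [Submodule.mem_comap, hπ]
    exact bk_mem_lieSpan s _ hx hy
  · refine lieSpan_le ?_ ?_
    · rintro _ ⟨x, hx, rfl⟩
      exact ⟨x, subset_lieSpan sF S hx, rfl⟩
    · rintro _ ⟨x, hx, rfl⟩ _ ⟨y, hy, rfl⟩
      exact ⟨sF.bk x y, bk_mem_lieSpan sF S hx hy, hπ x y⟩

theorem image_bkSet {sF : SuperAlg K F} {s : SuperAlg K L} {π : F →ₗ[K] L}
    (hπ : ∀ x y, π (sF.bk x y) = s.bk (π x) (π y)) (hπs : Function.Surjective π) :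
    π '' bkSet sF = bkSet s := by
  ext z
  constructor
  · rintro ⟨_, ⟨a, b, rfl⟩, rfl⟩
    exact ⟨π a, π b, hπ a b⟩
  · rintro ⟨x, y, rfl⟩
    obtain ⟨a, rfl⟩ := hπs x
    obtain ⟨b, rfl⟩ := hπs y
    exact ⟨sF.bk a b, ⟨a, b, rfl⟩, hπ a b⟩

theorem map_derived {sF : SuperAlg K F} {s : SuperAlg K L} {π : F →ₗ[K] L}
    (hπ : ∀ x y, π (sF.bk x y) = s.bk (π x) (π y)) (hπs : Function.Surjective π) :
    (derived sF).map π = derived s := by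
  rw [derived, Submodule.map_span, image_bkSet hπ hπs, derived]

/-- If `T` contains the kernel of a surjective homomorphism `π`, then `π` maps
`⟨K(F) ∩ T⟩` onto `⟨K(L) ∩ π(T)⟩`. -/
theorem map_lieSpan_bkSet_inter {sF : SuperAlg K F} {s : SuperAlg K L} {π : F →ₗ[K] L}
    (hπ : ∀ x y, π (sF.bk x y) = s.bk (π x) (π y)) (hπs : Function.Surjective π)
    {T : Submodule K F} (hT : LinearMap.ker π ≤ T) :
    (lieSpan sF (bkSet sF ∩ (T : Set F))).map π =
      lieSpan s (bkSet s ∩ (T.map π : Set L)) := by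
  have hpre : (T : Set F) = π ⁻¹' (T.map π : Set L) := by
    rw [← Submodule.comap_coe, Submodule.comap_map_eq_self hT]
  rw [map_lieSpan hπ, ← image_bkSet hπ hπs, ← Set.image_inter_preimage, ← hpre]

end LieSpan

/-- Let `L` be a Lie superalgebra with free presentation
`0 → R → F →π L → 0` and let `T` be a graded ideal of `F` with `R ≤ T`, and
`M = T/R = π(T)` the corresponding ideal of `L`.  Then the sequence
`0 → (R ∩ ⟨K(F) ∩ T⟩)/⟨K(F) ∩ R⟩ → B̃₀(L) → B̃₀(L/M) → (M ∩ L²)/⟨K(L) ∩ M⟩ → 0`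
is exact, where by the Hopf-type formula `B̃₀(L) = (R ∩ F²)/⟨K(F) ∩ R⟩` and
`B̃₀(L/M) = (T ∩ F²)/⟨K(F) ∩ T⟩`, and the maps `g1, g2, g3` are the canonical ones. -/
theorem four_term_exact_sequence
    {K : Type u} [CommRing K] {L F : Type v}
    [AddCommGroup L] [Module K L] [AddCommGroup F] [Module K F]
    (s : SuperAlg K L)
    (sF : SuperAlg K F) (X : ZMod 2 → Set F) (hF : IsFreeSuper sF X)
    (π : F →ₗ[K] L) (hπ : IsSuperHom sF s π) (hπs : Function.Surjective π)
    (T : Submodule K F) (hT : IsGradedIdeal sF T) (hRT : LinearMap.ker π ≤ T)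
    (g1 : (↥(LinearMap.ker π ⊓ lieSpan sF (bkSet sF ∩ (T : Set F))) ⧸
        Submodule.comap (LinearMap.ker π ⊓ lieSpan sF (bkSet sF ∩ (T : Set F))).subtype
          (lieSpan sF (bkSet sF ∩ (LinearMap.ker π : Set F)))) →ₗ[K]
      (↥(LinearMap.ker π ⊓ derived sF) ⧸
        Submodule.comap (LinearMap.ker π ⊓ derived sF).subtype
          (lieSpan sF (bkSet sF ∩ (LinearMap.ker π : Set F)))))
    (hg1 : ∀ (a : F) (ha : a ∈ LinearMap.ker π ⊓ lieSpan sF (bkSet sF ∩ (T : Set F)))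
        (ha' : a ∈ LinearMap.ker π ⊓ derived sF),
      g1 (Submodule.Quotient.mk ⟨a, ha⟩) = Submodule.Quotient.mk ⟨a, ha'⟩)
    (g2 : (↥(LinearMap.ker π ⊓ derived sF) ⧸
        Submodule.comap (LinearMap.ker π ⊓ derived sF).subtype
          (lieSpan sF (bkSet sF ∩ (LinearMap.ker π : Set F)))) →ₗ[K]
      (↥(T ⊓ derived sF) ⧸
        Submodule.comap (T ⊓ derived sF).subtype
          (lieSpan sF (bkSet sF ∩ (T : Set F)))))
    (hg2 : ∀ (a : F) (ha : a ∈ LinearMap.ker π ⊓ derived sF) (ha' : a ∈ T ⊓ derived sF),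
      g2 (Submodule.Quotient.mk ⟨a, ha⟩) = Submodule.Quotient.mk ⟨a, ha'⟩)
    (g3 : (↥(T ⊓ derived sF) ⧸
        Submodule.comap (T ⊓ derived sF).subtype
          (lieSpan sF (bkSet sF ∩ (T : Set F)))) →ₗ[K]
      (↥(T.map π ⊓ derived s) ⧸
        Submodule.comap (T.map π ⊓ derived s).subtype
          (lieSpan s (bkSet s ∩ (T.map π : Set L)))))
    (hg3 : ∀ (a : F) (ha : a ∈ T ⊓ derived sF) (ha' : π a ∈ T.map π ⊓ derived s),
      g3 (Submodule.Quotient.mk ⟨a, ha⟩) = Submodule.Quotient.mk ⟨π a, ha'⟩) :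
    Function.Injective g1 ∧
    LinearMap.range g1 = LinearMap.ker g2 ∧
    LinearMap.range g2 = LinearMap.ker g3 ∧
    Function.Surjective g3 := by
  have hderT := lieSpan_bkSet_inter_le_derived sF (T : Set F)
  have hmap := map_lieSpan_bkSet_inter hπ.1 hπs hRT
  have hder := map_derived hπ.1 hπs
  have hmem : ∀ a ∈ T ⊓ derived sF, π a ∈ T.map π ⊓ derived s := fun a ha =>
    ⟨Submodule.mem_map_of_mem ha.1, hder ▸ Submodule.mem_map_of_mem ha.2⟩
  refine ⟨?_, ?_, ?_, ?_⟩
  · rw [← LinearMap.ker_eq_bot, LinearMap.ker_eq_bot']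
    intro q hq
    obtain ⟨⟨a, ha⟩, rfl⟩ := Submodule.Quotient.mk_surjective _ q
    rw [hg1 a ha ⟨ha.1, hderT ha.2⟩, Submodule.Quotient.mk_eq_zero] at hq
    rw [Submodule.Quotient.mk_eq_zero]
    exact hq
  · ext q
    obtain ⟨⟨a, ha⟩, rfl⟩ := Submodule.Quotient.mk_surjective _ q
    rw [LinearMap.mem_ker, hg2 a ha ⟨hRT ha.1, ha.2⟩, Submodule.Quotient.mk_eq_zero]
    constructor
    · rintro ⟨p, hp⟩
      obtain ⟨⟨b, hb⟩, rfl⟩ := Submodule.Quotient.mk_surjective _ p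
      rw [hg1 b hb ⟨hb.1, hderT hb.2⟩, Submodule.Quotient.eq] at hp
      have hba : b - a ∈ lieSpan sF (bkSet sF ∩ (T : Set F)) :=
        lieSpan_mono sF (Set.inter_subset_inter_right _ hRT) hp
      exact (Submodule.sub_mem_iff_right _ hb.2).1 hba
    · intro h
      exact ⟨Submodule.Quotient.mk ⟨a, ha.1, h⟩, hg1 a ⟨ha.1, h⟩ ha⟩
  · ext q
    obtain ⟨⟨a, ha⟩, rfl⟩ := Submodule.Quotient.mk_surjective _ q
    rw [LinearMap.mem_ker, hg3 a ha (hmem a ha), Submodule.Quotient.mk_eq_zero,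
      Submodule.mem_comap, Submodule.subtype_apply, ← hmap]
    constructor
    · rintro ⟨p, hp⟩
      obtain ⟨⟨b, hb⟩, rfl⟩ := Submodule.Quotient.mk_surjective _ p
      rw [hg2 b hb ⟨hRT hb.1, hb.2⟩, Submodule.Quotient.eq] at hp
      have hba : b - a ∈ lieSpan sF (bkSet sF ∩ (T : Set F)) := hp
      refine ⟨a - b, by simpa using neg_mem hba, ?_⟩
      rw [map_sub, LinearMap.mem_ker.1 hb.1, sub_zero]
    · rintro ⟨b, hb, hba⟩
      have hab : a - b ∈ LinearMap.ker π ⊓ derived sF :=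
        ⟨LinearMap.mem_ker.2 (by rw [map_sub, hba, sub_self]), sub_mem ha.2 (hderT hb)⟩
      refine ⟨Submodule.Quotient.mk ⟨a - b, hab⟩, ?_⟩
      rw [hg2 _ hab ⟨hRT hab.1, hab.2⟩, Submodule.Quotient.eq]
      simpa using hb
  · intro q
    obtain ⟨⟨y, hyT, hyD⟩, rfl⟩ := Submodule.Quotient.mk_surjective _ q
    obtain ⟨a, haD, rfl⟩ := Submodule.mem_map.1 (hder.symm ▸ hyD)
    have haT : a ∈ T := by
      rw [← Submodule.comap_map_eq_self hRT]
      exact hyT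
    exact ⟨Submodule.Quotient.mk ⟨a, haT, haD⟩, hg3 a ⟨haT, haD⟩ ⟨hyT, hyD⟩⟩

end BogomolovSuper
end
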